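/- Let C be a bounded open convex subset of ℝⁿ, x ∈ C, and R > 0. Then ((e^{2R}−1)/(2e^{2R}))ⁿ ≤ vol_e(B_R(x)) / vol_e(TB_1(x)) ≤ ((e^{2R}−1)/2)ⁿ, where B_R(x) = {y ∈ C : d_C(x,y) < R} is the Hilbert metric ball, TB_1(x) = {u ∈ ℝⁿ : ‖u‖_{C,x} < 1} is the tangent unit ball at x, and vol_e is Lebesgue measure. -/

import Mathlib

open MeasureTheory Set Filter
open scoped ENNReal NNReal

noncomputable section

/-- Euclidean `n`-space. -/
abbrev Euc (n : ℕ) : Type := EuclideanSpace ℝ (Fin n)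

/-- The set of parameters `t` such that `p + t • v` lies in `C`. For `C` open bounded
convex, `p ∈ C` and `v ≠ 0` this is an open interval `(t⁻, t⁺)` with `t⁻ < 0 < t⁺`;
the points `p + t⁻ • v` and `p + t⁺ • v` are the two intersections of the boundary `∂C`
with the line through `p` directed by `v`. -/
def lineParams {n : ℕ} (C : Set (Euc n)) (p v : Euc n) : Set ℝ := {t : ℝ | p + t • v ∈ C}

open Classical in
/-- The Hilbert distance of the convex set `C`: with `a = p + t⁻ • (q - p)` and
`b = p + t⁺ • (q - p)` the two boundary points (so that `a, p, q, b` are in this order),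
the cross-ratio `(‖q-a‖ ‖p-b‖)/(‖p-a‖ ‖q-b‖)` equals `((1 - t⁻) t⁺)/((-t⁻)(t⁺ - 1))`. -/
def hDist {n : ℕ} (C : Set (Euc n)) (p q : Euc n) : ℝ :=
  if p = q then 0
  else
    (1 / 2) * Real.log
      (((1 - sInf (lineParams C p (q - p))) * sSup (lineParams C p (q - p))) /
        ((-sInf (lineParams C p (q - p))) * (sSup (lineParams C p (q - p)) - 1)))

open Classical in
/-- The Hilbert Finsler norm of `u` at `p`: with `p⁺ = p + t⁺ • u`, `p⁻ = p + t⁻ • u`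
the two boundary points on the line through `p` directed by `u`, one has
`(1/2)‖u‖(1/‖p-p⁺‖ + 1/‖p-p⁻‖) = (1/2)(1/t⁺ - 1/t⁻)`. -/
def fNorm {n : ℕ} (C : Set (Euc n)) (p u : Euc n) : ℝ :=
  if u = 0 then 0
  else (1 / 2) * (1 / sSup (lineParams C p u) - 1 / sInf (lineParams C p u))

/-- The dual norm of a linear form `l` at `p`: `sup {l u : ‖u‖_{C,p} = 1}`. -/
def dualNorm {n : ℕ} (C : Set (Euc n)) (p : Euc n) (l : Euc n →L[ℝ] ℝ) : ℝ :=
  sSup ((fun u => l u) '' {u : Euc n | fNorm C p u = 1})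

/-- The tangent ball `TB_R(p) = {u : ‖u‖_{C,p} < R}`. -/
def tangentBall {n : ℕ} (C : Set (Euc n)) (p : Euc n) (R : ℝ) : Set (Euc n) :=
  {u : Euc n | fNorm C p u < R}

/-- `ωₙ`, the Lebesgue volume of the Euclidean unit ball of `ℝⁿ`. -/
def omegaVol (n : ℕ) : ℝ := (volume (Metric.ball (0 : Euc n) 1)).toReal

/-- The Hilbert (Busemann) measure of `C`: density `ωₙ / vol_e(TB_C(p))` against
Lebesgue measure, supported on `C`. -/
def hMeasure {n : ℕ} (C : Set (Euc n)) : Measure (Euc n) :=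
  (volume.restrict C).withDensity fun p =>
    ENNReal.ofReal (omegaVol n / (volume (tangentBall C p 1)).toReal)

/-- Admissible test functions: nonzero Lipschitz functions with compact support
contained in `Ω`. -/
def testFuns {n : ℕ} (Ω : Set (Euc n)) : Set (Euc n → ℝ) :=
  {f : Euc n → ℝ |
    (∃ K : ℝ≥0, LipschitzWith K f) ∧ f ≠ 0 ∧ HasCompactSupport f ∧ tsupport f ⊆ Ω}

/-- The Rayleigh quotient of `f` on `Ω`, with respect to the Hilbert geometry of `C`
(`df` is the a.e.-defined differential of the Lipschitz function `f`). -/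
def rayleigh {n : ℕ} (C Ω : Set (Euc n)) (f : Euc n → ℝ) : ℝ :=
  (∫ p in Ω, dualNorm C p (fderiv ℝ f p) ^ 2 ∂hMeasure C) /
    ∫ p in Ω, f p ^ 2 ∂hMeasure C

/-- The Dirichlet bottom of the spectrum `λ₁^C(Ω)`. -/
def lambda1D {n : ℕ} (C Ω : Set (Euc n)) : ℝ := sInf (rayleigh C Ω '' testFuns Ω)

/-- The bottom of the spectrum `λ₁(C)` of the Hilbert geometry of `C`. -/
def lambda1 {n : ℕ} (C : Set (Euc n)) : ℝ := lambda1D C C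

/-- The Gromov product `(x|y)_t = (d(x,t) + d(y,t) - d(x,y))/2`. -/
def gromovProd {n : ℕ} (d : Euc n → Euc n → ℝ) (x y t : Euc n) : ℝ :=
  (d x t + d y t - d x y) / 2

/-- `(C, d_C)` is `δ`-hyperbolic: for all `x y z t` in `C`,
`(x|y)_t ≥ min((x|z)_t, (y|z)_t) - δ`. -/
def IsDeltaHyp {n : ℕ} (C : Set (Euc n)) (δ : ℝ) : Prop :=
  ∀ x ∈ C, ∀ y ∈ C, ∀ z ∈ C, ∀ t ∈ C,
    gromovProd (hDist C) x y t ≥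
      min (gromovProd (hDist C) x z t) (gromovProd (hDist C) y z t) - δ

/-- The metric ball `B_R(x)` of the Hilbert metric of `C`. -/
def hBall {n : ℕ} (C : Set (Euc n)) (x : Euc n) (R : ℝ) : Set (Euc n) :=
  {y ∈ C | hDist C x y < R}

/-- The image of `C` under the homothety of center `P₀` and ratio `r`. -/
def homoth {n : ℕ} (P₀ : Euc n) (r : ℝ) (C : Set (Euc n)) : Set (Euc n) :=
  (fun x => P₀ + r • (x - P₀)) '' C

/-- Diameter of a set with respect to a distance function `d`. -/
def ediamD {α : Type*} (d : α → α → ℝ) (S : Set α) : ℝ≥0∞ :=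
  ⨆ x ∈ S, ⨆ y ∈ S, ENNReal.ofReal (d x y)

/-- The `k`-dimensional Hausdorff measure of `S` with respect to the distance
function `d`. -/
def hausD {α : Type*} (k : ℝ) (d : α → α → ℝ) (S : Set α) : ℝ≥0∞ :=
  ⨆ (ε : ℝ≥0∞) (_ : 0 < ε),
    ⨅ (U : ℕ → Set α) (_ : S ⊆ ⋃ i, U i) (_ : ∀ i, ediamD d (U i) ≤ ε),
      ∑' i, ediamD d (U i) ^ k

/-- The frontier of `U` is a rectifiable closed curve (for the Hilbert metric of `C`):
it is the image of a closed continuous curve and has finite one-dimensional Hausdorff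
measure. -/
def RectCurveBoundary (C U : Set (Euc 2)) : Prop :=
  ∃ c : ℝ → Euc 2, ContinuousOn c (Icc 0 1) ∧ c '' Icc (0 : ℝ) 1 = frontier U ∧
    c 0 = c 1 ∧ hausD 1 (hDist C) (frontier U) < ⊤

/-- The Cheeger constant `I_∞^C(Ω)` in dimension `2`: infimum of
`ν_C(∂U)/μ_C(U)` over open sets `U` with closure contained in `Ω` whose boundary is a
rectifiable curve, `ν_C` being the `1`-dimensional Hausdorff measure of `(C, d_C)`. -/
def cheeger2D (C Ω : Set (Euc 2)) : ℝ :=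
  sInf {r : ℝ | ∃ U : Set (Euc 2), IsOpen U ∧ U.Nonempty ∧ closure U ⊆ Ω ∧
    RectCurveBoundary C U ∧
    r = (hausD 1 (hDist C) (frontier U)).toReal / (hMeasure C U).toReal}

/-- The Cheeger constant `I_∞(C)` of a planar Hilbert geometry. -/
def cheeger2 (C : Set (Euc 2)) : ℝ := cheeger2D C C

/-- `S` is a `C¹` hypersurface: near each of its points it is the zero set of a `C¹`
function with nonvanishing differential. -/
def IsC1Hypersurface {n : ℕ} (S : Set (Euc n)) : Prop :=
  ∀ x ∈ S, ∃ (f : Euc n → ℝ) (U : Set (Euc n)), U ∈ nhds x ∧ ContDiffOn ℝ 1 f U ∧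
    (∀ y ∈ U, fderiv ℝ f y ≠ 0) ∧ S ∩ U = {y ∈ U | f y = 0}

/-- The Cheeger constant `I_∞^C(Ω)` in dimension `n`: infimum of `ν_C(∂U)/μ_C(U)` over
open sets `U` with closure contained in `Ω` whose boundary is a `C¹` hypersurface,
`ν_C` being the `(n-1)`-dimensional Hausdorff measure of `(C, d_C)`. -/
def cheegerND {n : ℕ} (C Ω : Set (Euc n)) : ℝ :=
  sInf {r : ℝ | ∃ U : Set (Euc n), IsOpen U ∧ U.Nonempty ∧ closure U ⊆ Ω ∧
    IsC1Hypersurface (frontier U) ∧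
    r = (hausD ((n : ℝ) - 1) (hDist C) (frontier U)).toReal / (hMeasure C U).toReal}

/-- The boundary of the convex set `C` is of class `C¹`: through each boundary point
passes a unique supporting hyperplane. -/
def HasC1Boundary {n : ℕ} (C : Set (Euc n)) : Prop :=
  ∀ x ∈ frontier C, ∃! l : Euc n →L[ℝ] ℝ, ‖l‖ = 1 ∧ ∀ y ∈ C, l y ≤ l x

/-- The convex set `C` is strictly convex: the open segment joining two distinct
boundary points is contained in `C`. -/
def IsStrictlyConvexSet {n : ℕ} (C : Set (Euc n)) : Prop :=
  ∀ x ∈ frontier C, ∀ y ∈ frontier C, x ≠ y → openSegment ℝ x y ⊆ C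

end


open Pointwise in
lemma lp_smul {n : ℕ} (C : Set (Euc n)) (x u : Euc n) (c : ℝ) (hc : 0 < c) :
    lineParams C x (c • u) = c⁻¹ • lineParams C x u := by
  ext t
  rw [Set.mem_inv_smul_set_iff₀ hc.ne']
  simp only [lineParams, Set.mem_setOf_eq, smul_smul, smul_eq_mul, mul_comm]

lemma lp_facts {n : ℕ} (C : Set (Euc n)) (hconv : Convex ℝ C) (hopen : IsOpen C)
    (hbdd : Bornology.IsBounded C) (x : Euc n) (hx : x ∈ C) (u : Euc n) (hu : u ≠ 0) :
    0 < sSup (lineParams C x u) ∧ sInf (lineParams C x u) < 0 ∧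
      (1 < sSup (lineParams C x u) ↔ x + u ∈ C) := by
  have hcont : Continuous (fun t : ℝ => x + t • u) := by fun_prop
  have ho : IsOpen (lineParams C x u) := hopen.preimage hcont
  have h0 : (0 : ℝ) ∈ lineParams C x u := by simpa [lineParams] using hx
  obtain ⟨M, hM⟩ := hbdd.subset_closedBall x
  have hun : 0 < ‖u‖ := norm_pos_iff.mpr hu
  have hb : ∀ t ∈ lineParams C x u, |t| ≤ M / ‖u‖ := by
    intro t ht
    have := hM ht
    rw [le_div_iff₀ hun]
    simpa [Metric.mem_closedBall, dist_eq_norm, norm_smul] using this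
  have hA : BddAbove (lineParams C x u) := ⟨M / ‖u‖, fun t ht => (abs_le.mp (hb t ht)).2⟩
  have hB : BddBelow (lineParams C x u) := ⟨-(M / ‖u‖), fun t ht => (abs_le.mp (hb t ht)).1⟩
  have hlt : ∀ t ∈ lineParams C x u, t < sSup (lineParams C x u) ∧ sInf (lineParams C x u) < t := by
    intro t ht
    obtain ⟨ε, hε, hs⟩ := Metric.isOpen_iff.mp ho t ht
    have h1 : t + ε / 2 ∈ lineParams C x u := hs (by
      rw [Metric.mem_ball, Real.dist_eq]; rw [abs_lt]; constructor <;> linarith)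
    have h2 : t - ε / 2 ∈ lineParams C x u := hs (by
      rw [Metric.mem_ball, Real.dist_eq]; rw [abs_lt]; constructor <;> linarith)
    have h3 := le_csSup hA h1
    have h4 := csInf_le hB h2
    constructor <;> linarith
  refine ⟨(hlt 0 h0).1, (hlt 0 h0).2, ?_, ?_⟩
  · intro h
    obtain ⟨t, ht, h1t⟩ := exists_lt_of_lt_csSup ⟨0, h0⟩ h
    have := hconv.add_smul_mem hx ht (t := t⁻¹) ⟨by positivity, inv_le_one_of_one_le₀ h1t.le⟩
    rwa [smul_smul, inv_mul_cancel₀ (by positivity), one_smul] at this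
  · intro h
    exact (hlt 1 (by simpa [lineParams] using h)).1

lemma fNorm_smul' {n : ℕ} (C : Set (Euc n)) (x u : Euc n) (c : ℝ) (hc : 0 < c) :
    fNorm C x (c • u) = c * fNorm C x u := by
  unfold fNorm
  by_cases hu : u = 0
  · simp [hu]
  · rw [if_neg hu, if_neg (by simp [hu, hc.ne']), lp_smul C x u c hc,
      Real.sSup_smul_of_nonneg (by positivity), Real.sInf_smul_of_nonneg (by positivity)]
    simp only [smul_eq_mul, one_div, mul_inv, inv_inv]
    ring

/-- key description of the ball -/
lemma ball_iff {n : ℕ} (C : Set (Euc n)) (hconv : Convex ℝ C) (hopen : IsOpen C)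
    (hbdd : Bornology.IsBounded C) (x : Euc n) (hx : x ∈ C) (R : ℝ)
    (u : Euc n) (hu : u ≠ 0) : ∃ a b : ℝ, 0 < a ∧ 0 < b ∧ fNorm C x u = (a + b) / 2 ∧
      (x + u ∈ hBall C x R ↔ a < 1 ∧ b + Real.exp (2 * R) * a < Real.exp (2 * R) - 1) := by
  obtain ⟨h1, h2, h3⟩ := lp_facts C hconv hopen hbdd x hx u hu
  have hD : hDist C x (x + u) = (1 / 2) * Real.log
      (((1 - sInf (lineParams C x u)) * sSup (lineParams C x u)) /
        ((-sInf (lineParams C x u)) * (sSup (lineParams C x u) - 1))) := by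
    unfold hDist
    rw [if_neg (by simpa using hu), add_sub_cancel_left]
  have hF : fNorm C x u = (1 / 2) * (1 / sSup (lineParams C x u) - 1 / sInf (lineParams C x u)) := by
    unfold fNorm
    rw [if_neg hu]
  generalize sSup (lineParams C x u) = T at *
  generalize sInf (lineParams C x u) = S at *
  have hS : 0 < -S := by linarith
  refine ⟨1 / T, 1 / (-S), by positivity, by positivity, ?_, ?_⟩
  · rw [hF, one_div_neg_eq_neg_one_div]; ring
  · have e1 : 1 / T < 1 ↔ x + u ∈ C := by
      rw [div_lt_one h1, h3]
    unfold hBall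
    rw [Set.mem_setOf_eq, e1, hD]
    refine and_congr_right fun hC => ?_
    have hT : 0 < T - 1 := by linarith [h3.mpr hC]
    have hp : 0 < ((1 - S) * T) / ((-S) * (T - 1)) := by
      have : 0 < 1 - S := by linarith
      positivity
    have e2 : (1 / 2) * Real.log (((1 - S) * T) / ((-S) * (T - 1))) < R ↔
        Real.log (((1 - S) * T) / ((-S) * (T - 1))) < 2 * R := by
      constructor <;> intro h <;> linarith
    rw [e2, Real.log_lt_iff_lt_exp hp, div_lt_iff₀ (by positivity)]
    generalize Real.exp (2 * R) = E
    have e3 : E - 1 - (1 / (-S) + E * (1 / T)) =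
        (E * (-S * (T - 1)) - (1 - S) * T) / (-S * T) := by
      have := h2.ne
      field_simp
      ring
    rw [← sub_pos, ← sub_pos (a := E - 1), e3, div_pos_iff_of_pos_right (by positivity)]

lemma tb_pos {n : ℕ} (C : Set (Euc n)) (hopen : IsOpen C)
    (hconv : Convex ℝ C) (hbdd : Bornology.IsBounded C)
    (x : Euc n) (hx : x ∈ C) : 0 < volume (tangentBall C x 1) := by
  obtain ⟨r, hr, hs⟩ := Metric.isOpen_iff.mp hopen x hx
  refine (Metric.measure_ball_pos volume (0 : Euc n) hr).trans_le (measure_mono ?_)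
  intro u hu
  rw [mem_ball_zero_iff] at hu
  by_cases h0 : u = 0
  · simp [tangentBall, fNorm, h0]
  have hm : ∀ v : Euc n, ‖v‖ < r → x + v ∈ C := fun v hv => hs (by simpa using hv)
  have hl : lineParams C x (-u) = -lineParams C x u := by
    ext t; simp [lineParams]
  obtain ⟨h1, h2, h3⟩ := lp_facts C hconv hopen hbdd x hx u h0
  obtain ⟨-, -, h4⟩ := lp_facts C hconv hopen hbdd x hx (-u) (by simpa using h0)
  have k1 := h3.mpr (hm u hu)
  have k2 := h4.mpr (hm (-u) (by simpa using hu))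
  rw [hl, Real.sSup_neg] at k2
  show fNorm C x u < 1
  unfold fNorm
  rw [if_neg h0]
  generalize sSup (lineParams C x u) = T at *
  generalize sInf (lineParams C x u) = S at *
  have a1 : 1 / T < 1 := by rw [div_lt_one h1]; exact k1
  have a2 : 1 / (-S) < 1 := by rw [div_lt_one (by linarith)]; exact k2
  rw [one_div_neg_eq_neg_one_div] at a2
  linarith

open Pointwise in
lemma vol_aff {n : ℕ} (x : Euc n) (c : ℝ) (hc : 0 < c) (s : Set (Euc n)) :
    volume (x +ᵥ (c • s)) = ENNReal.ofReal (c ^ n) * volume s := by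
  rw [measure_vadd, Measure.addHaar_smul, finrank_euclideanSpace_fin, abs_of_pos (by positivity)]

open Pointwise in
/-- comparison of the Lebesgue volumes of the metric ball `B_R(x)` and
the tangent unit ball `TB_1(x)`:
`((e^{2R}-1)/(2e^{2R}))ⁿ ≤ vol_e(B_R(x))/vol_e(TB_1(x)) ≤ ((e^{2R}-1)/2)ⁿ`. -/
theorem stmt12 {n : ℕ} (C : Set (Euc n)) (hconv : Convex ℝ C) (hopen : IsOpen C)
    (hbdd : Bornology.IsBounded C) (hne : C.Nonempty)
    (x : Euc n) (hx : x ∈ C) (R : ℝ) (hR : 0 < R) :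
    ((Real.exp (2 * R) - 1) / (2 * Real.exp (2 * R))) ^ n ≤
        (volume (hBall C x R)).toReal / (volume (tangentBall C x 1)).toReal ∧
      (volume (hBall C x R)).toReal / (volume (tangentBall C x 1)).toReal ≤
        ((Real.exp (2 * R) - 1) / 2) ^ n := by
  set E := Real.exp (2 * R) with hE
  have hE1 : 1 < E := Real.one_lt_exp_iff.mpr (by linarith)
  have hball0 : x ∈ hBall C x R := ⟨hx, by simpa [hDist] using hR⟩
  have hl : 0 < (E - 1) / (2 * E) := div_pos (by linarith) (by linarith)
  have hc : 0 < (E - 1) / 2 := by linarith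
  have low : x +ᵥ (((E - 1) / (2 * E)) • tangentBall C x 1) ⊆ hBall C x R := by
    rintro _ ⟨_, ⟨u, hu, rfl⟩, rfl⟩
    simp only [vadd_eq_add]
    by_cases h0 : u = 0
    · simpa [h0] using hball0
    obtain ⟨a, b, ha, hb, hf, hiff⟩ := ball_iff C hconv hopen hbdd x hx R
      (((E - 1) / (2 * E)) • u) (by simp [h0, hl.ne'])
    rw [hiff]
    rw [fNorm_smul' C x u _ hl] at hf
    have h1 : fNorm C x u < 1 := hu
    have h2 : (a + b) / 2 < (E - 1) / (2 * E) := by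
      rw [← hf]; exact mul_lt_of_lt_one_right hl h1
    rw [lt_div_iff₀ (by linarith)] at h2
    have h3 : E * a + E * b < E - 1 := by linarith
    have h4 : b ≤ E * b := le_mul_of_one_le_left hb.le hE1.le
    constructor
    · by_contra h
      nlinarith
    · rw [← hE]; linarith
  have up : hBall C x R ⊆ x +ᵥ (((E - 1) / 2) • tangentBall C x 1) := by
    intro y hy
    refine ⟨y - x, ?_, by simp⟩
    rw [Set.mem_smul_set_iff_inv_smul_mem₀ hc.ne']
    show fNorm C x _ < 1
    rw [fNorm_smul' C x _ _ (by positivity), inv_mul_lt_iff₀ hc, mul_one]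
    by_cases h0 : y - x = 0
    · simpa [h0, fNorm] using hc
    obtain ⟨a, b, ha, hb, hf, hiff⟩ := ball_iff C hconv hopen hbdd x hx R (y - x) h0
    have := hiff.mp (by simpa using hy)
    rw [hf]
    have h4 : a ≤ E * a := le_mul_of_one_le_left ha.le hE1.le
    linarith [this.2]
  have hfin : volume (hBall C x R) ≠ ⊤ :=
    ((measure_mono (fun y hy => hy.1)).trans_lt hbdd.measure_lt_top).ne
  have vlow := measure_mono (μ := volume) low
  have vup := measure_mono (μ := volume) up
  rw [vol_aff x _ hl] at vlow
  rw [vol_aff x _ hc] at vup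
  have hpos := tb_pos C hopen hconv hbdd x hx
  have htb : volume (tangentBall C x 1) ≠ ⊤ := by
    intro h
    rw [h, ENNReal.mul_top (by simpa using pow_pos hl n)] at vlow
    exact hfin (top_le_iff.mp vlow)
  have hp : 0 < (volume (tangentBall C x 1)).toReal := ENNReal.toReal_pos hpos.ne' htb
  rw [le_div_iff₀ hp, div_le_iff₀ hp]
  constructor
  · have := ENNReal.toReal_mono hfin vlow
    rwa [ENNReal.toReal_mul, ENNReal.toReal_ofReal (pow_pos hl n).le] at this
  · have := ENNReal.toReal_mono (ENNReal.mul_ne_top ENNReal.ofReal_ne_top htb) vup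
    rwa [ENNReal.toReal_mul, ENNReal.toReal_ofReal (pow_pos hc n).le] at this
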